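/- Every Sp-invariant bilinear form on the curvature space 𝓡 is a real linear combination of the two total contractions B₁ and B₂; that is, if B : 𝓡 × 𝓡 → ℝ is bilinear and satisfies B(M·R, M·R') = B(R, R') for every M ∈ Sp(2n,ℝ) and all R, R' ∈ 𝓡, then there exist real numbers α, β with B = α·B₁ + β·B₂, where B₁(R,R') := Σ_{i,j,k,l,a,b,c,d} Ω^{ia} Ω^{jb} Ω^{kc} Ω^{ld} R(e_i,e_j,e_k,e_l) R'(e_a,e_b,e_c,e_d) and B₂(R,R') := Σ_{i,j,a,b} Ω^{ia} Ω^{jb} ρ_R(i,j) ρ_{R'}(a,b), with ρ_R(i,j) := Σ_{k,l} Ω^{kl} R(e_i,e_j,e_k,e_l). -/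

import Mathlib

/-- `V n = ℝ^{2n}`, realized with index set `Fin n ⊕ Fin n` (as in Mathlib's
`Matrix.J` and `Matrix.symplecticGroup`). -/
abbrev V (n : ℕ) : Type := (Fin n ⊕ Fin n) → ℝ

/-- The space of 4-multilinear forms on `V n`. -/
abbrev M4 (n : ℕ) := MultilinearMap ℝ (fun _ : Fin 4 => V n) ℝ

/-- The inverse symplectic matrix `Ω = J⁻¹`. -/
noncomputable def Om (n : ℕ) : Matrix (Fin n ⊕ Fin n) (Fin n ⊕ Fin n) ℝ :=
  (Matrix.J (Fin n) ℝ)⁻¹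

/-- The standard basis vector `e i` of `V n`. -/
def e (n : ℕ) (i : Fin n ⊕ Fin n) : V n := Pi.single i 1

/-- Membership in `𝓡`, the space of (symplectic) curvature-like tensors: symmetry in
the first two arguments, antisymmetry in the last two, and the first Bianchi
identity. -/
def IsR (n : ℕ) (R : M4 n) : Prop :=
  (∀ x y z w : V n, R ![x, y, z, w] = R ![y, x, z, w]) ∧
  (∀ x y z w : V n, R ![x, y, z, w] = - R ![x, y, w, z]) ∧
  (∀ x y z w : V n, R ![x, y, z, w] + R ![x, z, w, y] + R ![x, w, y, z] = 0)

/-- The action of a matrix `M` on a 4-multilinear form :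
`(M·R)(x₁,x₂,x₃,x₄) = R(M⁻¹x₁, M⁻¹x₂, M⁻¹x₃, M⁻¹x₄)`. -/
noncomputable def matAct (n : ℕ) (M : Matrix (Fin n ⊕ Fin n) (Fin n ⊕ Fin n) ℝ)
    (R : M4 n) : M4 n :=
  R.compLinearMap fun _ => (M⁻¹).mulVecLin

/-- The `Ω`-trace `ρ_R(i,j) = Σ_{k,l} Ω^{kl} R(e_i,e_j,e_k,e_l)`. -/
noncomputable def rho (n : ℕ) (R : M4 n) (i j : Fin n ⊕ Fin n) : ℝ :=
  ∑ k, ∑ l, Om n k l * R ![e n i, e n j, e n k, e n l]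

/-- The full contraction `B₁(R,R') = Σ Ω^{ia} Ω^{jb} Ω^{kc} Ω^{ld} R_{ijkl} R'_{abcd}`. -/
noncomputable def B1 (n : ℕ) (R R' : M4 n) : ℝ :=
  ∑ i, ∑ j, ∑ k, ∑ l, ∑ a, ∑ b, ∑ c, ∑ d,
    Om n i a * Om n j b * Om n k c * Om n l d *
      R ![e n i, e n j, e n k, e n l] * R' ![e n a, e n b, e n c, e n d]

/-- The contraction of traces `B₂(R,R') = Σ Ω^{ia} Ω^{jb} ρ_R(i,j) ρ_{R'}(a,b)`. -/
noncomputable def B2 (n : ℕ) (R R' : M4 n) : ℝ :=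
  ∑ i, ∑ j, ∑ a, ∑ b, Om n i a * Om n j b * rho n R i j * rho n R' a b

section SymplecticInvariants

variable {E : Type*} [AddCommGroup E] [Module ℝ E] {ω : E →ₗ[ℝ] E →ₗ[ℝ] ℝ}

/-- The map `x ↦ x + t ω(u, x) u`. -/
def sympTransvection (ω : E →ₗ[ℝ] E →ₗ[ℝ] ℝ) (t : ℝ) (u : E) : E →ₗ[ℝ] E :=
  LinearMap.id + t • (ω u).smulRight u

lemma sympTransvection_apply (t : ℝ) (u x : E) :
    sympTransvection ω t u x = x + (t * ω u x) • u := by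
  simp [sympTransvection, smul_smul]

lemma sympTransvection_preserves (hω : ω.IsAlt) (t : ℝ) (u x y : E) :
    ω (sympTransvection ω t u x) (sympTransvection ω t u y) = ω x y := by
  simp only [sympTransvection_apply, map_add, map_smul, LinearMap.add_apply,
    LinearMap.smul_apply, smul_eq_mul, hω u, ← hω.neg x u]
  ring

/-- If `ω x y ≠ 0`, then a transvection along `y - x` sends `x` to `y`. -/
lemma sympTransvection_sub (hω : ω.IsAlt) {x y : E} (h : ω x y ≠ 0) :
    sympTransvection ω (-(ω x y)⁻¹) (y - x) x = y := by
  have : ω (y - x) x = - ω x y := by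
    simp [hω x, ← hω.neg x y]
  rw [sympTransvection_apply, this]
  simp [h]

lemma sympTransvection_of_eq_zero {t : ℝ} {u x : E} (h : ω u x = 0) :
    sympTransvection ω t u x = x := by
  simp [sympTransvection_apply, h]

lemma exists_ne_zero_of_ne_zero (hs : ω.SeparatingLeft) {x : E} (hx : x ≠ 0) :
    ∃ y, ω x y ≠ 0 := by
  by_contra! h
  exact hx (hs x h)

lemma exists_common_ne_zero (hω : ω.IsAlt) (hs : ω.SeparatingLeft) {x y : E} (hx : x ≠ 0)
    (hy : y ≠ 0) : ∃ z, ω x z ≠ 0 ∧ ω z y ≠ 0 := by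
  obtain ⟨p, hp⟩ := exists_ne_zero_of_ne_zero hs hx
  obtain ⟨q, hq⟩ := exists_ne_zero_of_ne_zero hs hy
  rw [← hω.neg, neg_ne_zero] at hq
  by_cases h1 : ω p y = 0
  · by_cases h2 : ω x q = 0
    · exact ⟨p + q, by simpa [h2] using hp, by simpa [h1] using hq⟩
    · exact ⟨q, h2, hq⟩
  · exact ⟨p, hp, h1⟩

/-- A predicate on pairs that is stable under isometries of `ω` and holds at one hyperbolic pair
holds at all of them. -/
lemma hyperbolicPair_induction (hω : ω.IsAlt) (hs : ω.SeparatingLeft) {P : E → E → Prop}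
    (hP : ∀ t u a c, P a c → P (sympTransvection ω t u a) (sympTransvection ω t u c))
    {a c a' c' : E} (hac : ω a c = 1) (hac' : ω a' c' = 1) (h : P a c) : P a' c' := by
  have move : ∀ {a a' c : E}, ω a a' ≠ 0 → ω a c = 1 → P a c → ∃ c', ω a' c' = 1 ∧ P a' c' := by
    intro a a' c haa hac h
    have h1 := hP (-(ω a a')⁻¹) (a' - a) a c h
    have h2 := sympTransvection_preserves hω (-(ω a a')⁻¹) (a' - a) a c
    rw [sympTransvection_sub hω haa] at h1 h2
    exact ⟨_, h2.trans hac, h1⟩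
  have ha : a ≠ 0 := by rintro rfl; simp at hac
  have ha' : a' ≠ 0 := by rintro rfl; simp at hac'
  obtain ⟨z, hz, hz'⟩ := exists_common_ne_zero hω hs ha ha'
  obtain ⟨c₁, hc₁, h₁⟩ := move hz hac h
  obtain ⟨c₂, hc₂, h₂⟩ := move hz' hc₁ h₁
  have fix : ∀ {c c' : E}, ω c c' ≠ 0 → ω a' c = 1 → ω a' c' = 1 → P a' c → P a' c' := by
    intro c c' hcc h1 h2 h
    have h3 := hP (-(ω c c')⁻¹) (c' - c) a' c h
    rwa [sympTransvection_sub hω hcc, sympTransvection_of_eq_zero] at h3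
    rw [← hω.neg]; simp [h1, h2]
  by_cases h0 : ω c₂ c' = 0
  · have hc₃ : ω a' (a' + c₂) = 1 := by simp [hω a', hc₂]
    refine fix (c := a' + c₂) ?_ hc₃ hac' (fix ?_ hc₂ hc₃ h₂)
    · simp [h0, hac']
    · rw [← hω.neg]
      simp [hω c₂, hc₂]
  · exact fix h0 hc₂ hac' h₂

/-- A bilinear form that is invariant under the transvections along `u` agrees with a multiple of
`ω` as soon as one of the arguments is `u`. -/
lemma exists_eq_mul_of_invariant (hω : ω.IsAlt) (hs : ω.SeparatingLeft)
    {h : E →ₗ[ℝ] E →ₗ[ℝ] ℝ} {u : E}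
    (hinv : ∀ t b d, h (sympTransvection ω t u b) (sympTransvection ω t u d) = h b d) :
    ∃ l, ∀ d, h u d = l * ω u d ∧ h d u = l * ω d u := by
  have key : ∀ b d, ω u b * h u d + ω u d * h b u = 0 := by
    intro b d
    have h1 := hinv 1 b d
    have h2 := hinv (-1) b d
    simp only [sympTransvection_apply, map_add, map_smul, LinearMap.add_apply,
      LinearMap.smul_apply, smul_eq_mul] at h1 h2
    linarith
  by_cases hu : u = 0
  · exact ⟨0, by simp [hu]⟩
  obtain ⟨v, hv⟩ := exists_ne_zero_of_ne_zero hs hu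
  have h1 : ∀ d, h u d = (-h v u / ω u v) * ω u d := fun d => by
    field_simp
    linarith [key v d]
  refine ⟨-h v u / ω u v, fun d => ⟨h1 d, ?_⟩⟩
  have h2 := key d v
  rw [h1 v] at h2
  rw [← hω.neg u d]
  refine mul_left_cancel₀ hv ?_
  linear_combination h2

/-- The shape of the bilinear forms invariant under the isometries fixing a hyperbolic pair. -/
lemma exists_coeff_of_hyperbolicPair (hω : ω.IsAlt) (hs : ω.SeparatingLeft)
    {h : E →ₗ[ℝ] E →ₗ[ℝ] ℝ} {a c : E} (hac : ω a c = 1)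
    (hinv : ∀ t u b d, ω u a = 0 → ω u c = 0 →
      h (sympTransvection ω t u b) (sympTransvection ω t u d) = h b d)
    (ha : ∀ d, h a d = 0) (hc : ∀ b, h b c = 0) :
    ∃ α β : ℝ, ∀ b d, h b d = α * (ω b d - ω a d * ω b c) + β * (ω a b * ω c d) := by
  have hca : ω c a = -1 := by rw [← hω.neg, hac]
  have hmul : ∀ u, ω u a = 0 → ω u c = 0 → ∃ l, ∀ d, h u d = l * ω u d ∧ h d u = l * ω d u :=
    fun u h1 h2 => exists_eq_mul_of_invariant hω hs fun t b d => hinv t u b d h1 h2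
  have hdec : ∀ b, ∃ b', ω b' a = 0 ∧ ω b' c = 0 ∧ b = b' + ω a b • c + ω b c • a := by
    intro b
    refine ⟨b - ω a b • c - ω b c • a, ?_, ?_, by abel⟩
    · simp [hca, hω a, ← hω.neg a b]
    · simp [hac, hω c]
  have hunif : ∃ l, ∀ u, ω u a = 0 → ω u c = 0 → ∀ d, h u d = l * ω u d ∧ h d u = l * ω d u := by
    by_cases hex : ∃ u₀, ω u₀ a = 0 ∧ ω u₀ c = 0 ∧ u₀ ≠ 0
    · obtain ⟨u₀, ha₀, hc₀, hne⟩ := hex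
      obtain ⟨l, hl⟩ := hmul u₀ ha₀ hc₀
      refine ⟨l, fun u hua huc => ?_⟩
      by_cases hu : u = 0
      · simp [hu]
      obtain ⟨w, hw, hw'⟩ := exists_common_ne_zero hω hs hne hu
      obtain ⟨w', hwa, hwc, hww⟩ := hdec w
      obtain ⟨l', hl'⟩ := hmul w' hwa hwc
      obtain ⟨l'', hl''⟩ := hmul u hua huc
      have e1 : ω u₀ w' ≠ 0 := by rw [hww] at hw; simpa [ha₀, hc₀] using hw
      have e2 : ω w' u ≠ 0 := by
        rw [hww] at hw'
        simpa [← hω.neg u a, ← hω.neg u c, hua, huc] using hw'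
      have e3 : l = l' := mul_right_cancel₀ e1 ((hl w').1.symm.trans (hl' u₀).2)
      have e4 : l' = l'' := mul_right_cancel₀ e2 ((hl' u).1.symm.trans (hl'' w').2)
      rwa [e3, e4]
    · push Not at hex
      exact ⟨0, fun u h1 h2 => by simp [hex u h1 h2]⟩
  obtain ⟨l, hl⟩ := hunif
  refine ⟨l, -(l + h c a), fun b d => ?_⟩
  obtain ⟨b', hba, hbc, hb⟩ := hdec b
  obtain ⟨d', hda, hdc, hd⟩ := hdec d
  have h1 : h b d = h b' d + ω a b * h c d := by
    conv_lhs => rw [hb]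
    simp [ha]
  have h2 : h c d = ω d c * h c a := by
    conv_lhs => rw [hd]
    simp [hc, (hl d' hda hdc c).2, ← hω.neg d' c, hdc]
  have h3 : ω b d = ω b' d + ω a b * ω c d + ω b c * ω a d := by
    conv_lhs => rw [hb]
    simp
  rw [h1, h2, (hl b' hba hbc d).1, h3, ← hω.neg c d]
  ring

/-- The first fundamental theorem for the symplectic group in the only multidegree needed here:
invariants of four vectors of multidegree `(3, 1, 3, 1)` vanishing when the second vector equals
the first or the fourth equals the third. -/
theorem exists_coeff_of_invariant (hω : ω.IsAlt) (hs : ω.SeparatingLeft)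
    (f : E → E → E →ₗ[ℝ] E →ₗ[ℝ] ℝ)
    (hinv : ∀ t u a c b d, f (sympTransvection ω t u a) (sympTransvection ω t u c)
      (sympTransvection ω t u b) (sympTransvection ω t u d) = f a c b d)
    (hsmul : ∀ (s : ℝ) a c b d, f (s • a) c b d = s ^ 3 * f a c b d)
    (hcubic : ∀ a x c b d, 6 * f a c b d = 4 * f (a + x) c b d + 4 * f (a - x) c b d
      - f (a + (2 : ℝ) • x) c b d - f (a - (2 : ℝ) • x) c b d)
    (hzero : ∀ a b d, f a 0 b d = 0)
    (ha : ∀ a c d, f a c a d = 0) (hc : ∀ a c b, f a c b c = 0) :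
    ∃ α β : ℝ, ∀ a b c d, f a c b d =
      α * (ω a c ^ 2 * (ω a c * ω b d - ω a d * ω b c)) +
      β * (ω a c ^ 2 * (ω a b * ω c d)) := by
  by_cases hV : ∀ c : E, c = 0
  · exact ⟨0, 0, fun a b c d => by simp [hV c, hzero]⟩
  push Not at hV
  obtain ⟨a₀, ha₀⟩ := hV
  obtain ⟨c₀, hc₀⟩ := exists_ne_zero_of_ne_zero hs ha₀
  have hac₀ : ω a₀ ((ω a₀ c₀)⁻¹ • c₀) = 1 := by simp [hc₀]
  generalize (ω a₀ c₀)⁻¹ • c₀ = c₁ at hac₀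
  obtain ⟨α, β, hαβ⟩ := exists_coeff_of_hyperbolicPair (h := f a₀ c₁) hω hs hac₀
    (fun t u b d h1 h2 => by
      simpa only [sympTransvection_of_eq_zero h1, sympTransvection_of_eq_zero h2] using
        hinv t u a₀ c₁ b d) (ha _ _) (hc _ _)
  refine ⟨α, β, ?_⟩
  have hyp : ∀ a c, ω a c = 1 → ∀ b d, f a c b d =
      α * (ω b d - ω a d * ω b c) + β * (ω a b * ω c d) := by
    intro a c hac
    refine hyperbolicPair_induction (P := fun a c => ∀ b d, f a c b d =
      α * (ω b d - ω a d * ω b c) + β * (ω a b * ω c d)) hω hs ?_ hac₀ hac hαβ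
    intro t u a c h b d
    have hsurj : ∀ x, ∃ y, x = sympTransvection ω t u y := fun x =>
      ⟨sympTransvection ω (-t) u x, by simp [sympTransvection_apply, hω u]⟩
    obtain ⟨b, rfl⟩ := hsurj b
    obtain ⟨d, rfl⟩ := hsurj d
    simp only [hinv, sympTransvection_preserves hω, h]
  have gen : ∀ a b c d, ω a c ≠ 0 → f a c b d =
      α * (ω a c ^ 2 * (ω a c * ω b d - ω a d * ω b c)) +
      β * (ω a c ^ 2 * (ω a b * ω c d)) := by
    intro a b c d hac
    have h1 := hyp ((ω a c)⁻¹ • a) c (by simp [hac]) b d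
    rw [hsmul] at h1
    simp only [map_smul, LinearMap.smul_apply, smul_eq_mul] at h1
    field_simp at h1
    rw [h1]
    ring
  intro a b c d
  by_cases hac : ω a c = 0
  · by_cases hc0 : c = 0
    · simp [hc0, hzero]
    obtain ⟨x, hx⟩ := exists_ne_zero_of_ne_zero hs hc0
    rw [← hω.neg, neg_ne_zero] at hx
    have h1 := hcubic a x c b d
    rw [gen (a + x) _ _ _ (by simpa [hac] using hx), gen (a - x) _ _ _ (by simpa [hac] using hx),
      gen (a + (2 : ℝ) • x) _ _ _ (by simpa [hac] using hx),
      gen (a - (2 : ℝ) • x) _ _ _ (by simpa [hac] using hx)] at h1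
    simp only [map_add, map_sub, map_smul, LinearMap.add_apply, LinearMap.sub_apply,
      LinearMap.smul_apply, smul_eq_mul, hac] at h1 ⊢
    linear_combination h1 / 6
  · exact gen a b c d hac

end SymplecticInvariants

section CurvatureSpace

variable {n : ℕ}

/-- The elementary tensor `φ₀ ⊗ φ₁ ⊗ φ₂ ⊗ φ₃` of four linear functionals. -/
noncomputable def tens (φ : Fin 4 → Module.Dual ℝ (V n)) : M4 n :=
  (MultilinearMap.mkPiAlgebra ℝ (Fin 4) ℝ).compLinearMap φ

lemma tens_apply (φ₀ φ₁ φ₂ φ₃ : Module.Dual ℝ (V n)) (x y z w : V n) :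
    tens ![φ₀, φ₁, φ₂, φ₃] ![x, y, z, w] = φ₀ x * φ₁ y * φ₂ z * φ₃ w := by
  simp [tens, Fin.prod_univ_four]

/-- The curvature tensor `φ² ⊗ (φ ∧ ψ)`. -/
noncomputable def curv (φ ψ : Module.Dual ℝ (V n)) : M4 n :=
  tens ![φ, φ, φ, ψ] - tens ![φ, φ, ψ, φ]

lemma curv_apply (φ ψ : Module.Dual ℝ (V n)) (x y z w : V n) :
    curv φ ψ ![x, y, z, w] = φ x * φ y * (φ z * ψ w - ψ z * φ w) := by
  rw [curv, sub_apply, tens_apply, tens_apply]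
  ring

lemma ext_of_apply_eq {R S : M4 n} (h : ∀ x y z w, R ![x, y, z, w] = S ![x, y, z, w]) : R = S := by
  refine MultilinearMap.ext fun v => ?_
  have : v = ![v 0, v 1, v 2, v 3] := by
    ext i : 1
    fin_cases i <;> rfl
  rw [this]
  exact h _ _ _ _

lemma isR_curv (φ ψ : Module.Dual ℝ (V n)) : IsR n (curv φ ψ) := by
  refine ⟨fun x y z w => ?_, fun x y z w => ?_, fun x y z w => ?_⟩ <;>
    simp only [curv_apply] <;> ring

lemma IsR.add {R S : M4 n} (hR : IsR n R) (hS : IsR n S) : IsR n (R + S) := by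
  obtain ⟨h1, h2, h3⟩ := hR
  obtain ⟨k1, k2, k3⟩ := hS
  refine ⟨fun x y z w => ?_, fun x y z w => ?_, fun x y z w => ?_⟩ <;>
    simp only [add_apply]
  · rw [h1, k1]
  · rw [h2, k2]; ring
  · linarith [h3 x y z w, k3 x y z w]

lemma IsR.smul {R : M4 n} (c : ℝ) (hR : IsR n R) : IsR n (c • R) := by
  obtain ⟨h1, h2, h3⟩ := hR
  refine ⟨fun x y z w => ?_, fun x y z w => ?_, fun x y z w => ?_⟩ <;>
    simp only [smul_apply, smul_eq_mul]
  · rw [h1]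
  · rw [h2]; ring
  · linear_combination c * h3 x y z w

lemma isR_zero : IsR n (0 : M4 n) := by
  refine ⟨fun x y z w => ?_, fun x y z w => ?_, fun x y z w => ?_⟩ <;> simp

/-- The span of the tensors `φ² ⊗ (φ ∧ ψ)`. -/
noncomputable def curvSpan (n : ℕ) : Submodule ℝ (M4 n) :=
  Submodule.span ℝ (Set.range fun p : Module.Dual ℝ (V n) × Module.Dual ℝ (V n) => curv p.1 p.2)

/-- The complete polarization of `curv` in its first argument. -/
noncomputable def polCurv (φ₁ φ₂ φ₃ ψ : Module.Dual ℝ (V n)) : M4 n :=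
  curv (φ₁ + φ₂ + φ₃) ψ - curv (φ₁ + φ₂) ψ - curv (φ₁ + φ₃) ψ - curv (φ₂ + φ₃) ψ
    + curv φ₁ ψ + curv φ₂ ψ + curv φ₃ ψ

lemma polCurv_mem (φ₁ φ₂ φ₃ ψ : Module.Dual ℝ (V n)) : polCurv φ₁ φ₂ φ₃ ψ ∈ curvSpan n := by
  have h : ∀ φ ψ : Module.Dual ℝ (V n), curv φ ψ ∈ curvSpan n := fun φ ψ =>
    Submodule.subset_span ⟨(φ, ψ), rfl⟩
  unfold polCurv
  exact add_mem (add_mem (add_mem (sub_mem (sub_mem (sub_mem (h _ _) (h _ _)) (h _ _)) (h _ _))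
    (h _ _)) (h _ _)) (h _ _)

lemma polCurv_apply (φ₁ φ₂ φ₃ ψ : Module.Dual ℝ (V n)) (x y z w : V n) :
    polCurv φ₁ φ₂ φ₃ ψ ![x, y, z, w] =
      φ₁ x * φ₂ y * φ₃ z * ψ w + φ₁ x * φ₂ z * φ₃ y * ψ w + φ₁ y * φ₂ x * φ₃ z * ψ w
      + φ₁ y * φ₂ z * φ₃ x * ψ w + φ₁ z * φ₂ x * φ₃ y * ψ w + φ₁ z * φ₂ y * φ₃ x * ψ w
      - (φ₁ x * φ₂ y * φ₃ w * ψ z + φ₁ x * φ₂ w * φ₃ y * ψ z + φ₁ y * φ₂ x * φ₃ w * ψ z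
      + φ₁ y * φ₂ w * φ₃ x * ψ z + φ₁ w * φ₂ x * φ₃ y * ψ z + φ₁ w * φ₂ y * φ₃ x * ψ z) := by
  simp only [polCurv, add_apply, sub_apply, curv_apply,
    LinearMap.add_apply]
  ring

/-- The expansion of a 4-linear form in coordinates. -/
lemma apply_eq_sum_coord (R : M4 n) (x y z w : V n) :
    R ![x, y, z, w] = ∑ i, ∑ j, ∑ k, ∑ l,
      R ![e n i, e n j, e n k, e n l] * (x i * y j * z k * w l) := by
  have h : R = ∑ i, ∑ j, ∑ k, ∑ l, R ![e n i, e n j, e n k, e n l] •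
      tens ![LinearMap.proj i, LinearMap.proj j, LinearMap.proj k, LinearMap.proj l] := by
    refine Module.Basis.ext_multilinear (fun _ => Pi.basisFun ℝ (Fin n ⊕ Fin n)) fun v => ?_
    have hv : (fun i => Pi.basisFun ℝ (Fin n ⊕ Fin n) (v i)) =
        ![e n (v 0), e n (v 1), e n (v 2), e n (v 3)] := by
      ext i : 1
      fin_cases i <;> simp [e]
    rw [hv]
    simp only [sum_apply, smul_apply, tens_apply, smul_eq_mul]
    simp [e, Pi.single_apply]
  conv_lhs => rw [h]
  simp only [sum_apply, smul_apply, tens_apply, smul_eq_mul,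
    LinearMap.proj_apply]

/-- The curvature space is spanned by the tensors `φ² ⊗ (φ ∧ ψ)`. -/
lemma IsR.mem_curvSpan {R : M4 n} (hR : IsR n R) : R ∈ curvSpan n := by
  have h : R = (8 : ℝ)⁻¹ • ∑ i, ∑ j, ∑ k, ∑ l, R ![e n i, e n j, e n k, e n l] •
      polCurv (LinearMap.proj i) (LinearMap.proj j) (LinearMap.proj k) (LinearMap.proj l) := by
    refine ext_of_apply_eq fun x y z w => ?_
    obtain ⟨h1, h2, h3⟩ := hR
    have h8 : 8 * R ![x, y, z, w] =
        R ![x, y, z, w] + R ![x, z, y, w] + R ![y, x, z, w]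
        + R ![y, z, x, w] + R ![z, x, y, w] + R ![z, y, x, w]
        - (R ![x, y, w, z] + R ![x, w, y, z] + R ![y, x, w, z]
        + R ![y, w, x, z] + R ![w, x, y, z] + R ![w, y, x, z]) := by
      linarith [h1 x y z w, h1 x z y w, h1 y z x w, h1 x y w z, h1 x w y z, h1 y w x z,
        h2 x y z w, h2 x z y w, h2 y z x w, h2 x w y z, h2 y w x z, h3 x y z w, h3 y x z w]
    have hsum : 8 * R ![x, y, z, w] = (∑ i, ∑ j, ∑ k, ∑ l, R ![e n i, e n j, e n k, e n l] •
        polCurv (LinearMap.proj i) (LinearMap.proj j) (LinearMap.proj k) (LinearMap.proj l))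
          ![x, y, z, w] := by
      rw [h8]
      simp only [apply_eq_sum_coord R x y z w, apply_eq_sum_coord R x z y w, apply_eq_sum_coord R y x z w,
        apply_eq_sum_coord R y z x w, apply_eq_sum_coord R z x y w, apply_eq_sum_coord R z y x w,
        apply_eq_sum_coord R x y w z, apply_eq_sum_coord R x w y z, apply_eq_sum_coord R y x w z,
        apply_eq_sum_coord R y w x z, apply_eq_sum_coord R w x y z, apply_eq_sum_coord R w y x z]
      simp only [← Finset.sum_add_distrib, ← Finset.sum_sub_distrib, sum_apply, smul_apply,
        polCurv_apply, LinearMap.proj_apply, smul_eq_mul]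
      refine Finset.sum_congr rfl fun i _ => Finset.sum_congr rfl fun j _ =>
        Finset.sum_congr rfl fun k _ => Finset.sum_congr rfl fun l _ => ?_
      ring
    rw [smul_apply, ← hsum, smul_eq_mul]
    ring
  rw [h]
  exact Submodule.smul_mem _ _ <| sum_mem fun i _ => sum_mem fun j _ => sum_mem fun k _ =>
    sum_mem fun l _ => Submodule.smul_mem _ _ (polCurv_mem _ _ _ _)

/-- A function that is linear on the curvature space and vanishes on all `curv φ ψ` vanishes. -/
lemma eq_zero_of_curv {D : M4 n → ℝ}
    (hadd : ∀ R R', IsR n R → IsR n R' → D (R + R') = D R + D R')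
    (hsmul : ∀ (c : ℝ) R, IsR n R → D (c • R) = c * D R)
    (hcurv : ∀ φ ψ, D (curv φ ψ) = 0) {R : M4 n} (hR : IsR n R) : D R = 0 := by
  suffices h : IsR n R ∧ D R = 0 from h.2
  have hmem := hR.mem_curvSpan
  clear hR
  induction hmem using Submodule.span_induction with
  | mem R h =>
    obtain ⟨p, rfl⟩ := h
    exact ⟨isR_curv _ _, hcurv _ _⟩
  | zero => exact ⟨isR_zero, by simpa using hsmul 0 0 isR_zero⟩
  | add R R' _ _ h h' => exact ⟨h.1.add h'.1, by rw [hadd _ _ h.1 h'.1, h.2, h'.2, add_zero]⟩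
  | smul c R _ h => exact ⟨h.1.smul c, by rw [hsmul _ _ h.1, h.2, mul_zero]⟩

lemma curv_add_right (φ ψ ψ' : Module.Dual ℝ (V n)) :
    curv φ (ψ + ψ') = curv φ ψ + curv φ ψ' := by
  refine ext_of_apply_eq fun x y z w => ?_
  simp only [add_apply, curv_apply, LinearMap.add_apply]
  ring

lemma curv_smul_right (s : ℝ) (φ ψ : Module.Dual ℝ (V n)) :
    curv φ (s • ψ) = s • curv φ ψ := by
  refine ext_of_apply_eq fun x y z w => ?_
  simp only [smul_apply, curv_apply, LinearMap.smul_apply, smul_eq_mul]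
  ring

lemma curv_smul_left (s : ℝ) (φ ψ : Module.Dual ℝ (V n)) :
    curv (s • φ) ψ = s ^ 3 • curv φ ψ := by
  refine ext_of_apply_eq fun x y z w => ?_
  simp only [smul_apply, curv_apply, LinearMap.smul_apply, smul_eq_mul]
  ring

lemma curv_self (φ : Module.Dual ℝ (V n)) : curv φ φ = 0 := by
  refine ext_of_apply_eq fun x y z w => ?_
  rw [curv_apply, zero_apply]
  ring

/-- Lagrange interpolation of the cubic polynomial `t ↦ curv (φ + t • χ) ψ` at `t = 0`. -/
lemma curv_interpolation (φ χ ψ : Module.Dual ℝ (V n)) :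
    (6 : ℝ) • curv φ ψ + (curv (φ + (2 : ℝ) • χ) ψ + curv (φ - (2 : ℝ) • χ) ψ) =
      (4 : ℝ) • curv (φ + χ) ψ + (4 : ℝ) • curv (φ - χ) ψ := by
  refine ext_of_apply_eq fun x y z w => ?_
  simp only [add_apply, smul_apply, curv_apply, LinearMap.add_apply, LinearMap.sub_apply,
    LinearMap.smul_apply, smul_eq_mul]
  ring

end CurvatureSpace

section Contractions

variable {n : ℕ}

/-- The standard symplectic form `(x, y) ↦ xᵀ J y`. -/
noncomputable def symp (n : ℕ) : V n →ₗ[ℝ] V n →ₗ[ℝ] ℝ :=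
  Matrix.toLinearMap₂' ℝ (Matrix.J (Fin n) ℝ)

lemma symp_eq_dotProduct (x y : V n) : symp n x y = x ⬝ᵥ (Matrix.J (Fin n) ℝ).mulVec y :=
  Matrix.toLinearMap₂'_apply' _ _ _

lemma symp_apply (x y : V n) :
    symp n x y = ∑ i, (x (.inr i) * y (.inl i) - x (.inl i) * y (.inr i)) := by
  rw [symp_eq_dotProduct]
  simp [Matrix.J, dotProduct, Fintype.sum_sum_type, Matrix.fromBlocks_mulVec,
    Matrix.neg_mulVec, Finset.sum_sub_distrib]
  ring

lemma symp_isAlt : (symp n).IsAlt := fun x => by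
  rw [symp_apply]
  exact Finset.sum_eq_zero fun i _ => by ring

lemma symp_e_inl (x : V n) (i : Fin n) : symp n x (e n (.inl i)) = x (.inr i) := by
  simp [symp_apply, e, Pi.single_apply]

lemma symp_e_inr (x : V n) (i : Fin n) : symp n x (e n (.inr i)) = - x (.inl i) := by
  simp [symp_apply, e, Pi.single_apply]

lemma symp_separatingLeft : (symp n).SeparatingLeft := by
  intro x hx
  ext i
  cases i with
  | inl i => simpa [symp_e_inr] using hx (e n (.inr i))
  | inr i => simpa [symp_e_inl] using hx (e n (.inl i))

lemma symp_surjective : Function.Surjective (symp n) := by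
  refine (LinearMap.injective_iff_surjective_of_finrank_eq_finrank ?_).1 ?_
  · exact (Subspace.dual_finrank_eq).symm
  · rw [← LinearMap.ker_eq_bot]
    exact LinearMap.separatingLeft_iff_ker_eq_bot.1 symp_separatingLeft

/-- The contraction of two coordinate covectors with `Ω`. -/
noncomputable def contr (p q : Fin n ⊕ Fin n → ℝ) : ℝ :=
  ∑ i, ∑ j, Om n i j * p i * q j

lemma contr_symp (a c : V n) :
    contr (fun i => symp n a (e n i)) (fun i => symp n c (e n i)) = - symp n a c := by
  have hOm : Om n = - Matrix.J (Fin n) ℝ := Matrix.J_inv _ _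
  rw [contr, symp_apply, hOm]
  simp [Fintype.sum_sum_type, symp_e_inl, symp_e_inr, Matrix.J, Matrix.one_apply,
    Finset.sum_sub_distrib]
  ring

lemma sum_four_mul {ι : Type*} [Fintype ι] (A B C D : ι → ℝ) :
    ∑ a, ∑ b, ∑ c, ∑ d, A a * B b * C c * D d =
      (∑ a, A a) * (∑ b, B b) * (∑ c, C c) * ∑ d, D d := by
  simp only [← Finset.mul_sum, ← Finset.sum_mul]

lemma sum_contr (p₁ p₂ p₃ p₄ q₁ q₂ q₃ q₄ : Fin n ⊕ Fin n → ℝ) :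
    ∑ i, ∑ j, ∑ k, ∑ l, ∑ a, ∑ b, ∑ c, ∑ d,
      Om n i a * Om n j b * Om n k c * Om n l d *
        (p₁ i * p₂ j * p₃ k * p₄ l) * (q₁ a * q₂ b * q₃ c * q₄ d) =
      contr p₁ q₁ * contr p₂ q₂ * contr p₃ q₃ * contr p₄ q₄ := by
  unfold contr
  rw [← sum_four_mul]
  refine Finset.sum_congr rfl fun i _ => Finset.sum_congr rfl fun j _ =>
    Finset.sum_congr rfl fun k _ => Finset.sum_congr rfl fun l _ => ?_
  rw [← sum_four_mul]
  refine Finset.sum_congr rfl fun a _ => Finset.sum_congr rfl fun b _ =>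
    Finset.sum_congr rfl fun c _ => Finset.sum_congr rfl fun d _ => ?_
  ring

lemma B1_curv (a b c d : V n) :
    B1 n (curv (symp n a) (symp n b)) (curv (symp n c) (symp n d)) =
      2 * (symp n a c ^ 2 * (symp n a c * symp n b d - symp n a d * symp n b c)) := by
  set φ : V n → Fin n ⊕ Fin n → ℝ := fun x i => symp n x (e n i) with hφ
  have key : ∀ i j k l i' j' k' l',
      Om n i i' * Om n j j' * Om n k k' * Om n l l' *
        curv (symp n a) (symp n b) ![e n i, e n j, e n k, e n l] *
        curv (symp n c) (symp n d) ![e n i', e n j', e n k', e n l'] =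
      Om n i i' * Om n j j' * Om n k k' * Om n l l' *
        (φ a i * φ a j * φ a k * φ b l) * (φ c i' * φ c j' * φ c k' * φ d l')
      - Om n i i' * Om n j j' * Om n k k' * Om n l l' *
        (φ a i * φ a j * φ a k * φ b l) * (φ c i' * φ c j' * φ d k' * φ c l')
      - Om n i i' * Om n j j' * Om n k k' * Om n l l' *
        (φ a i * φ a j * φ b k * φ a l) * (φ c i' * φ c j' * φ c k' * φ d l')
      + Om n i i' * Om n j j' * Om n k k' * Om n l l' *
        (φ a i * φ a j * φ b k * φ a l) * (φ c i' * φ c j' * φ d k' * φ c l') := by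
    intros
    simp only [curv_apply, hφ]
    ring
  simp only [B1, key, Finset.sum_add_distrib, Finset.sum_sub_distrib, sum_contr]
  simp only [hφ, contr_symp]
  ring

lemma rho_curv (a b : V n) (i j : Fin n ⊕ Fin n) :
    rho n (curv (symp n a) (symp n b)) i j =
      -2 * symp n a b * (symp n a (e n i) * symp n a (e n j)) := by
  have h : rho n (curv (symp n a) (symp n b)) i j = symp n a (e n i) * symp n a (e n j) *
      (contr (fun i => symp n a (e n i)) (fun i => symp n b (e n i)) -
        contr (fun i => symp n b (e n i)) (fun i => symp n a (e n i))) := by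
    simp only [rho, contr, ← Finset.sum_sub_distrib, Finset.mul_sum, curv_apply]
    refine Finset.sum_congr rfl fun k _ => Finset.sum_congr rfl fun l _ => ?_
    ring
  rw [h, contr_symp, contr_symp, ← symp_isAlt.neg a b]
  ring

lemma B2_curv (a b c d : V n) :
    B2 n (curv (symp n a) (symp n b)) (curv (symp n c) (symp n d)) =
      4 * (symp n a c ^ 2 * (symp n a b * symp n c d)) := by
  have h : B2 n (curv (symp n a) (symp n b)) (curv (symp n c) (symp n d)) =
      4 * (symp n a b * symp n c d) *
        (contr (fun i => symp n a (e n i)) (fun i => symp n c (e n i)) *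
          contr (fun i => symp n a (e n i)) (fun i => symp n c (e n i))) := by
    simp only [B2, contr, rho_curv, Finset.sum_mul_sum]
    simp only [Finset.mul_sum]
    refine Finset.sum_congr rfl fun i _ => Finset.sum_congr rfl fun j _ =>
      Finset.sum_congr rfl fun k _ => Finset.sum_congr rfl fun l _ => ?_
    ring
  rw [h, contr_symp]
  ring

lemma B1_add_left (R R' S : M4 n) : B1 n (R + R') S = B1 n R S + B1 n R' S := by
  simp only [B1, add_apply, mul_add, add_mul, Finset.sum_add_distrib]

lemma B1_add_right (R S S' : M4 n) : B1 n R (S + S') = B1 n R S + B1 n R S' := by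
  simp only [B1, add_apply, mul_add, Finset.sum_add_distrib]

lemma B1_smul_left (t : ℝ) (R S : M4 n) : B1 n (t • R) S = t * B1 n R S := by
  simp only [B1, smul_apply, smul_eq_mul, Finset.mul_sum, mul_assoc, mul_left_comm _ t]

lemma B1_smul_right (t : ℝ) (R S : M4 n) : B1 n R (t • S) = t * B1 n R S := by
  simp only [B1, smul_apply, smul_eq_mul, Finset.mul_sum, mul_left_comm _ t]

lemma rho_add (R S : M4 n) (i j : Fin n ⊕ Fin n) :
    rho n (R + S) i j = rho n R i j + rho n S i j := by
  simp only [rho, add_apply, mul_add, Finset.sum_add_distrib]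

lemma rho_smul (t : ℝ) (R : M4 n) (i j : Fin n ⊕ Fin n) :
    rho n (t • R) i j = t * rho n R i j := by
  simp only [rho, smul_apply, smul_eq_mul, Finset.mul_sum, mul_left_comm _ t]

lemma B2_add_left (R R' S : M4 n) : B2 n (R + R') S = B2 n R S + B2 n R' S := by
  simp only [B2, rho_add, mul_add, add_mul, Finset.sum_add_distrib]

lemma B2_add_right (R S S' : M4 n) : B2 n R (S + S') = B2 n R S + B2 n R S' := by
  simp only [B2, rho_add, mul_add, Finset.sum_add_distrib]

lemma B2_smul_left (t : ℝ) (R S : M4 n) : B2 n (t • R) S = t * B2 n R S := by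
  simp only [B2, rho_smul, Finset.mul_sum, mul_assoc, mul_left_comm _ t]

lemma B2_smul_right (t : ℝ) (R S : M4 n) : B2 n R (t • S) = t * B2 n R S := by
  simp only [B2, rho_smul, Finset.mul_sum, mul_left_comm _ t]

lemma toMatrix'_mem_symplecticGroup {L : V n →ₗ[ℝ] V n}
    (hL : ∀ x y, symp n (L x) (L y) = symp n x y) :
    LinearMap.toMatrix' L ∈ Matrix.symplecticGroup (Fin n) ℝ := by
  rw [SymplecticGroup.mem_iff']
  have toBilin_injective : Function.Injective
      (Matrix.toLinearMap₂' ℝ : Matrix _ _ ℝ ≃ₗ[ℝ] (V n →ₗ[ℝ] V n →ₗ[ℝ] ℝ)) :=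
    LinearEquiv.injective _
  refine toBilin_injective (LinearMap.ext fun x => LinearMap.ext fun y => ?_)
  rw [Matrix.toLinearMap₂'_apply', Matrix.toLinearMap₂'_apply', ← symp_eq_dotProduct, ← hL,
    symp_eq_dotProduct, ← LinearMap.toMatrix'_mulVec L x, ← LinearMap.toMatrix'_mulVec L y,
    ← Matrix.mulVec_mulVec, ← Matrix.mulVec_mulVec, Matrix.dotProduct_mulVec,
    Matrix.vecMul_transpose]

lemma matAct_curv {L : V n →ₗ[ℝ] V n} (hL : ∀ x y, symp n (L x) (L y) = symp n x y) (a b : V n) :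
    matAct n (LinearMap.toMatrix' L) (curv (symp n a) (symp n b)) =
      curv (symp n (L a)) (symp n (L b)) := by
  have hM := SymplecticGroup.symplectic_det (toMatrix'_mem_symplecticGroup hL)
  have h : ∀ c x, symp n c ((LinearMap.toMatrix' L)⁻¹.mulVec x) = symp n (L c) x := by
    intro c x
    rw [← hL, ← LinearMap.toMatrix'_mulVec L (Matrix.mulVec _ _), Matrix.mulVec_mulVec,
      Matrix.mul_nonsing_inv _ hM, Matrix.one_mulVec]
  refine ext_of_apply_eq fun x y z w => ?_
  have hv : matAct n (LinearMap.toMatrix' L) (curv (symp n a) (symp n b)) ![x, y, z, w] =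
      curv (symp n a) (symp n b) ![(LinearMap.toMatrix' L)⁻¹.mulVec x,
        (LinearMap.toMatrix' L)⁻¹.mulVec y, (LinearMap.toMatrix' L)⁻¹.mulVec z,
        (LinearMap.toMatrix' L)⁻¹.mulVec w] := by
    rw [matAct, MultilinearMap.compLinearMap_apply]
    congr 1
    ext i : 1
    fin_cases i <;> rfl
  rw [hv, curv_apply, curv_apply]
  simp only [h]

end Contractions

/-- **Every `Sp(2n,ℝ)`-invariant bilinear form on the curvature space `𝓡` is a real
linear combination of the two total contractions `B₁` and `B₂`.** -/
theorem invariant_bilinear_forms_on_R (n : ℕ) (hn : 1 ≤ n)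
    (B : M4 n → M4 n → ℝ)
    (haddl : ∀ R R' S : M4 n, IsR n R → IsR n R' → IsR n S →
      B (R + R') S = B R S + B R' S)
    (haddr : ∀ R S S' : M4 n, IsR n R → IsR n S → IsR n S' →
      B R (S + S') = B R S + B R S')
    (hsmull : ∀ (c : ℝ) (R S : M4 n), IsR n R → IsR n S → B (c • R) S = c * B R S)
    (hsmulr : ∀ (c : ℝ) (R S : M4 n), IsR n R → IsR n S → B R (c • S) = c * B R S)
    (hinv : ∀ M ∈ Matrix.symplecticGroup (Fin n) ℝ, ∀ R S : M4 n, IsR n R → IsR n S →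
      B (matAct n M R) (matAct n M S) = B R S) :
    ∃ α β : ℝ, ∀ R S : M4 n, IsR n R → IsR n S →
      B R S = α * B1 n R S + β * B2 n R S := by
  let f : V n → V n → V n →ₗ[ℝ] V n →ₗ[ℝ] ℝ := fun a c =>
    LinearMap.mk₂ ℝ (fun b d => B (curv (symp n a) (symp n b)) (curv (symp n c) (symp n d)))
      (fun b b' d => by
        rw [map_add, curv_add_right, haddl _ _ _ (isR_curv _ _) (isR_curv _ _) (isR_curv _ _)])
      (fun s b d => by
        rw [map_smul, curv_smul_right, hsmull _ _ _ (isR_curv _ _) (isR_curv _ _), smul_eq_mul])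
      (fun b d d' => by
        rw [map_add, curv_add_right, haddr _ _ _ (isR_curv _ _) (isR_curv _ _) (isR_curv _ _)])
      (fun s b d => by
        rw [map_smul, curv_smul_right, hsmulr _ _ _ (isR_curv _ _) (isR_curv _ _), smul_eq_mul])
  have hf : ∀ a b c d, f a c b d = B (curv (symp n a) (symp n b)) (curv (symp n c) (symp n d)) :=
    fun _ _ _ _ => rfl
  have hzero_left : ∀ S, IsR n S → B 0 S = 0 := fun S hS => by
    simpa using hsmull 0 0 S isR_zero hS
  have hzero_right : ∀ R, IsR n R → B R 0 = 0 := fun R hR => by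
    simpa using hsmulr 0 R 0 hR isR_zero
  obtain ⟨α, β, hαβ⟩ := exists_coeff_of_invariant symp_isAlt symp_separatingLeft f
    (fun t u a c b d => by
      have hL := sympTransvection_preserves (ω := symp n) symp_isAlt t u
      rw [hf, hf, ← matAct_curv hL, ← matAct_curv hL]
      exact hinv _ (toMatrix'_mem_symplecticGroup hL) _ _ (isR_curv _ _) (isR_curv _ _))
    (fun s a c b d => by
      rw [hf, hf, map_smul, curv_smul_left, hsmull _ _ _ (isR_curv _ _) (isR_curv _ _)])
    (fun a x c b d => by
      have hS := isR_curv (symp n c) (symp n d)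
      have hc := fun φ => isR_curv φ (symp n b)
      have h := congrArg (fun R => B R (curv (symp n c) (symp n d)))
        (curv_interpolation (symp n a) (symp n x) (symp n b))
      beta_reduce at h
      rw [haddl _ _ _ ((hc _).smul _) ((hc _).add (hc _)) hS, haddl _ _ _ (hc _) (hc _) hS,
        haddl _ _ _ ((hc _).smul _) ((hc _).smul _) hS, hsmull _ _ _ (hc _) hS,
        hsmull _ _ _ (hc _) hS, hsmull _ _ _ (hc _) hS] at h
      simp only [hf, map_add, map_sub, map_smul]
      linarith)
    (fun a b d => by
      have h : curv (0 : Module.Dual ℝ (V n)) (symp n d) = 0 := by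
        simpa using curv_smul_left 0 0 (symp n d)
      rw [hf, map_zero, h, hzero_right _ (isR_curv _ _)])
    (fun a c d => by rw [hf, curv_self, hzero_left _ (isR_curv _ _)])
    (fun a c b => by rw [hf, curv_self, hzero_right _ (isR_curv _ _)])
  refine ⟨α / 2, β / 4, fun R S hR hS => ?_⟩
  suffices h : B R S - (α / 2 * B1 n R S + β / 4 * B2 n R S) = 0 from sub_eq_zero.1 h
  refine eq_zero_of_curv (D := fun R => B R S - (α / 2 * B1 n R S + β / 4 * B2 n R S))
    (fun R R' hR hR' => ?_) (fun s R hR => ?_) (fun φ ψ => ?_) hR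
  · rw [haddl _ _ _ hR hR' hS, B1_add_left, B2_add_left]
    ring
  · rw [hsmull _ _ _ hR hS, B1_smul_left, B2_smul_left]
    ring
  obtain ⟨a, rfl⟩ := symp_surjective φ
  obtain ⟨b, rfl⟩ := symp_surjective ψ
  refine eq_zero_of_curv (D := fun S => B (curv (symp n a) (symp n b)) S -
    (α / 2 * B1 n (curv (symp n a) (symp n b)) S + β / 4 * B2 n (curv (symp n a) (symp n b)) S))
    (fun S S' hS hS' => ?_) (fun s S hS => ?_) (fun φ ψ => ?_) hS
  · rw [haddr _ _ _ (isR_curv _ _) hS hS', B1_add_right, B2_add_right]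
    ring
  · rw [hsmulr _ _ _ (isR_curv _ _) hS, B1_smul_right, B2_smul_right]
    ring
  obtain ⟨c, rfl⟩ := symp_surjective φ
  obtain ⟨d, rfl⟩ := symp_surjective ψ
  rw [← hf, hαβ, B1_curv, B2_curv]
  ring
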